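/- Let J : 𝒜 → ℰ be a pseudofunctor, T a J-relative pseudomonad, (A, (-)^a, â, ã) and (B, (-)^b, b̂, b̃) T-pseudoalgebras, and (ν, ε) : ℓ ⊣ r an adjunction in ℰ with ℓ : A → B and r : B → A. Then: (i) the adjunction lifts along the forgetful pseudofunctor to an adjunction in PsAlg_l(T) (i.e. ℓ and r admit lax morphism structures making ν and ε transformations satisfying the triangle laws) if and only if the colax mate ℓ̄ of the given lax structure r̄ on r is invertible, i.e. (ℓ, ℓ̄⁻¹) is a pseudomorphism; (ii) dually, the adjunction lifts to an adjunction in PsAlg_c(T) if and only if the lax mate r̄ of the given colax structure ℓ̄ on ℓ is invertible. In each case the required structure on the other adjoint is constructed by taking mates. -/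

import Mathlib

open CategoryTheory Bicategory

universe w₁ v₁ u₁ w₂ v₂ u₂

section RelPsMnd

variable {𝒜 : Type u₁} [Bicategory.{w₁, v₁} 𝒜] {ℰ : Type u₂} [Bicategory.{w₂, v₂} ℰ]

/-- Precomposition with a fixed 1-cell, as a functor between hom-categories. -/
@[simps]
def precompF {a b : ℰ} (c : ℰ) (f : a ⟶ b) : (b ⟶ c) ⥤ (a ⟶ c) where
  obj g := f ≫ g
  map η := f ◁ η

/-- A pseudomonad relative to a pseudofunctor `J : 𝒜 ⥤ ℰ`, given in extension form:
an object assignment, extension operators, units, and invertible coherence 2-cells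
`mul` (μ), `eta` (η), `theta` (θ) subject to associativity and unit laws. -/
structure RelativePseudomonad (J : Pseudofunctor 𝒜 ℰ) where
  obj : 𝒜 → ℰ
  unit : ∀ X : 𝒜, J.obj X ⟶ obj X
  ext : ∀ {X Y : 𝒜}, (J.obj X ⟶ obj Y) ⥤ (obj X ⟶ obj Y)
  mul : ∀ {X Y Z : 𝒜} (f : J.obj X ⟶ obj Y) (g : J.obj Y ⟶ obj Z),
    ext.obj (f ≫ ext.obj g) ≅ ext.obj f ≫ ext.obj g
  eta : ∀ {X Y : 𝒜} (f : J.obj X ⟶ obj Y), f ≅ unit X ≫ ext.obj f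
  theta : ∀ X : 𝒜, ext.obj (unit X) ≅ 𝟙 (obj X)
  mul_natural : ∀ {X Y Z : 𝒜} {f f' : J.obj X ⟶ obj Y} {g g' : J.obj Y ⟶ obj Z}
    (α : f ⟶ f') (β : g ⟶ g'),
    ext.map (α ▷ ext.obj g ≫ f' ◁ ext.map β) ≫ (mul f' g').hom =
      (mul f g).hom ≫ (ext.map α ▷ ext.obj g ≫ ext.obj f' ◁ ext.map β)
  eta_natural : ∀ {X Y : 𝒜} {f f' : J.obj X ⟶ obj Y} (α : f ⟶ f'),
    α ≫ (eta f').hom = (eta f).hom ≫ unit X ◁ ext.map α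
  assoc : ∀ {W X Y Z : 𝒜} (f : J.obj W ⟶ obj X) (g : J.obj X ⟶ obj Y)
    (h : J.obj Y ⟶ obj Z),
    (mul f (g ≫ ext.obj h)).hom ≫ ext.obj f ◁ (mul g h).hom =
      ext.map (f ◁ (mul g h).hom) ≫ ext.map (α_ f (ext.obj g) (ext.obj h)).inv ≫
        (mul (f ≫ ext.obj g) h).hom ≫ (mul f g).hom ▷ ext.obj h ≫
        (α_ (ext.obj f) (ext.obj g) (ext.obj h)).hom
  unit_law : ∀ {X Y : 𝒜} (f : J.obj X ⟶ obj Y),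
    ext.map (eta f).hom ≫ (mul (unit X) f).hom ≫ (theta X).hom ▷ ext.obj f =
      (λ_ (ext.obj f)).inv

namespace RelativePseudomonad

variable {J : Pseudofunctor 𝒜 ℰ} (T : RelativePseudomonad J)

/-- The data of a pseudoalgebra for a relative pseudomonad on a carrier `C`:
extension operators `ext`, associativity 2-cells `ahat` (â) and unit 2-cells `atil` (ã). -/
structure AlgData (C : ℰ) where
  ext : ∀ (X : 𝒜), (J.obj X ⟶ C) ⥤ (T.obj X ⟶ C)
  ahat : ∀ {X Y : 𝒜} (f : J.obj X ⟶ T.obj Y) (g : J.obj Y ⟶ C),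
    (ext X).obj (f ≫ (ext Y).obj g) ≅ T.ext.obj f ≫ (ext Y).obj g
  atil : ∀ {X : 𝒜} (f : J.obj X ⟶ C), f ≅ T.unit X ≫ (ext X).obj f

/-- The pseudoalgebra axioms. -/
structure AlgData.Laws {C : ℰ} (S : T.AlgData C) : Prop where
  ahat_natural : ∀ {X Y : 𝒜} {f f' : J.obj X ⟶ T.obj Y} {g g' : J.obj Y ⟶ C}
    (α : f ⟶ f') (β : g ⟶ g'),
    (S.ext X).map (α ▷ (S.ext Y).obj g ≫ f' ◁ (S.ext Y).map β) ≫ (S.ahat f' g').hom =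
      (S.ahat f g).hom ≫ (T.ext.map α ▷ (S.ext Y).obj g ≫ T.ext.obj f' ◁ (S.ext Y).map β)
  atil_natural : ∀ {X : 𝒜} {f f' : J.obj X ⟶ C} (α : f ⟶ f'),
    α ≫ (S.atil f').hom = (S.atil f).hom ≫ T.unit X ◁ (S.ext X).map α
  assoc : ∀ {W X Y : 𝒜} (f : J.obj W ⟶ T.obj X) (g : J.obj X ⟶ T.obj Y)
    (h : J.obj Y ⟶ C),
    (S.ahat f (g ≫ (S.ext Y).obj h)).hom ≫ T.ext.obj f ◁ (S.ahat g h).hom =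
      (S.ext W).map (f ◁ (S.ahat g h).hom) ≫
        (S.ext W).map (α_ f (T.ext.obj g) ((S.ext Y).obj h)).inv ≫
        (S.ahat (f ≫ T.ext.obj g) h).hom ≫ (T.mul f g).hom ▷ (S.ext Y).obj h ≫
        (α_ (T.ext.obj f) (T.ext.obj g) ((S.ext Y).obj h)).hom
  unit : ∀ {X : 𝒜} (f : J.obj X ⟶ C),
    (S.ext X).map (S.atil f).hom ≫ (S.ahat (T.unit X) f).hom ≫
      (T.theta X).hom ▷ (S.ext X).obj f = (λ_ ((S.ext X).obj f)).inv

/-- A pseudoalgebra: data together with the laws. -/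
structure Algebra (C : ℰ) extends AlgData T C where
  laws : toAlgData.Laws

/-- The data of the free pseudoalgebra on an object of `𝒜`. -/
@[simps]
def freeAlgData (X : 𝒜) : T.AlgData (T.obj X) where
  ext _ := T.ext
  ahat f g := T.mul f g
  atil f := T.eta f

theorem freeAlgData_laws (X : 𝒜) : (T.freeAlgData X).Laws where
  ahat_natural := T.mul_natural
  atil_natural := T.eta_natural
  assoc := T.assoc
  unit := T.unit_law

/-- The free pseudoalgebra on `X`. -/
def freeAlgebra (X : 𝒜) : T.Algebra (T.obj X) := ⟨T.freeAlgData X, T.freeAlgData_laws X⟩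

variable {T}

/-- The data of a lax morphism of pseudoalgebras: a 1-cell between the carriers
together with the comparison 2-cells `lax`. -/
structure LaxData {C C' : ℰ} (S : T.AlgData C) (S' : T.AlgData C') where
  hom : C ⟶ C'
  lax : ∀ (X : 𝒜) (f : J.obj X ⟶ C),
    (S'.ext X).obj (f ≫ hom) ⟶ (S.ext X).obj f ≫ hom

/-- The axioms for a lax morphism of pseudoalgebras. -/
structure LaxData.IsLaxMorphism {C C' : ℰ} {S : T.AlgData C} {S' : T.AlgData C'}
    (m : LaxData S S') : Prop where
  natural : ∀ {X : 𝒜} {f f' : J.obj X ⟶ C} (α : f ⟶ f'),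
    (S'.ext X).map (α ▷ m.hom) ≫ m.lax X f' = m.lax X f ≫ (S.ext X).map α ▷ m.hom
  unit : ∀ {X : 𝒜} (f : J.obj X ⟶ C),
    (S'.atil (f ≫ m.hom)).hom ≫ T.unit X ◁ m.lax X f =
      (S.atil f).hom ▷ m.hom ≫ (α_ (T.unit X) ((S.ext X).obj f) m.hom).hom
  assoc : ∀ {X Y : 𝒜} (f : J.obj X ⟶ T.obj Y) (g : J.obj Y ⟶ C),
    (S'.ahat f (g ≫ m.hom)).hom ≫ T.ext.obj f ◁ m.lax Y g ≫
        (α_ (T.ext.obj f) ((S.ext Y).obj g) m.hom).inv =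
      (S'.ext X).map (f ◁ m.lax Y g) ≫
        (S'.ext X).map (α_ f ((S.ext Y).obj g) m.hom).inv ≫
        m.lax X (f ≫ (S.ext Y).obj g) ≫ (S.ahat f g).hom ▷ m.hom

/-- Pseudomorphisms are lax morphisms whose comparison 2-cells are invertible. -/
def LaxData.IsPseudoMorphism {C C' : ℰ} {S : T.AlgData C} {S' : T.AlgData C'}
    (m : LaxData S S') : Prop :=
  m.IsLaxMorphism ∧ ∀ (X : 𝒜) (f : J.obj X ⟶ C), IsIso (m.lax X f)

/-- The data of a colax morphism of pseudoalgebras. -/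
structure ColaxData {C C' : ℰ} (S : T.AlgData C) (S' : T.AlgData C') where
  hom : C ⟶ C'
  colax : ∀ (X : 𝒜) (f : J.obj X ⟶ C),
    (S.ext X).obj f ≫ hom ⟶ (S'.ext X).obj (f ≫ hom)

/-- The axioms for a colax morphism of pseudoalgebras. -/
structure ColaxData.IsColaxMorphism {C C' : ℰ} {S : T.AlgData C} {S' : T.AlgData C'}
    (m : ColaxData S S') : Prop where
  natural : ∀ {X : 𝒜} {f f' : J.obj X ⟶ C} (α : f ⟶ f'),
    m.colax X f ≫ (S'.ext X).map (α ▷ m.hom) = (S.ext X).map α ▷ m.hom ≫ m.colax X f'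
  unit : ∀ {X : 𝒜} (f : J.obj X ⟶ C),
    (S.atil f).hom ▷ m.hom ≫ (α_ (T.unit X) ((S.ext X).obj f) m.hom).hom ≫
        T.unit X ◁ m.colax X f =
      (S'.atil (f ≫ m.hom)).hom
  assoc : ∀ {X Y : 𝒜} (f : J.obj X ⟶ T.obj Y) (g : J.obj Y ⟶ C),
    (S.ahat f g).hom ▷ m.hom ≫ (α_ (T.ext.obj f) ((S.ext Y).obj g) m.hom).hom ≫
        T.ext.obj f ◁ m.colax Y g =
      m.colax X (f ≫ (S.ext Y).obj g) ≫
        (S'.ext X).map (α_ f ((S.ext Y).obj g) m.hom).hom ≫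
        (S'.ext X).map (f ◁ m.colax Y g) ≫ (S'.ahat f (g ≫ m.hom)).hom

/-- A 2-cell between (the underlying 1-cells of) two lax morphisms is a transformation. -/
def IsTransformation {C C' : ℰ} {S : T.AlgData C} {S' : T.AlgData C'}
    (m m' : LaxData S S') (α : m.hom ⟶ m'.hom) : Prop :=
  ∀ (X : 𝒜) (f : J.obj X ⟶ C),
    (S'.ext X).map (f ◁ α) ≫ m'.lax X f = m.lax X f ≫ (S.ext X).obj f ◁ α

/-- A 2-cell between (the underlying 1-cells of) two colax morphisms is a transformation. -/
def IsColaxTransformation {C C' : ℰ} {S : T.AlgData C} {S' : T.AlgData C'}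
    (m m' : ColaxData S S') (α : m.hom ⟶ m'.hom) : Prop :=
  ∀ (X : 𝒜) (f : J.obj X ⟶ C),
    (S.ext X).obj f ◁ α ≫ m'.colax X f = m.colax X f ≫ (S'.ext X).map (f ◁ α)

/-- The identity lax morphism data, with the canonical comparison 2-cells
`(1 ∘ f)^a ≅ f^a ≅ 1 ∘ f^a`. -/
@[simps]
def idLaxData {C : ℰ} (S : T.AlgData C) : LaxData S S where
  hom := 𝟙 C
  lax X f := (S.ext X).map (ρ_ f).hom ≫ (ρ_ ((S.ext X).obj f)).inv

/-- The composite of two lax morphism data. -/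
@[simps]
def compLaxData {C C' C'' : ℰ} {S : T.AlgData C} {S' : T.AlgData C'} {S'' : T.AlgData C''}
    (m : LaxData S S') (m' : LaxData S' S'') : LaxData S S'' where
  hom := m.hom ≫ m'.hom
  lax X f :=
    (S''.ext X).map (α_ f m.hom m'.hom).inv ≫ m'.lax X (f ≫ m.hom) ≫
      m.lax X f ▷ m'.hom ≫ (α_ ((S.ext X).obj f) m.hom m'.hom).hom

/-- The identity colax morphism data. -/
@[simps]
def idColaxData {C : ℰ} (S : T.AlgData C) : ColaxData S S where
  hom := 𝟙 C
  colax X f := (ρ_ ((S.ext X).obj f)).hom ≫ (S.ext X).map (ρ_ f).inv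

/-- The composite of two colax morphism data. -/
@[simps]
def compColaxData {C C' C'' : ℰ} {S : T.AlgData C} {S' : T.AlgData C'} {S'' : T.AlgData C''}
    (m : ColaxData S S') (m' : ColaxData S' S'') : ColaxData S S'' where
  hom := m.hom ≫ m'.hom
  colax X f :=
    (α_ ((S.ext X).obj f) m.hom m'.hom).inv ≫ m.colax X f ▷ m'.hom ≫
      m'.colax X (f ≫ m.hom) ≫ (S''.ext X).map (α_ f m.hom m'.hom).hom

/-- Morphisms of pseudoalgebras satisfying a property `P` (e.g. lax morphisms,
pseudomorphisms), which form a category under transformations. -/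
def Mor {C C' : ℰ} (S : T.AlgData C) (S' : T.AlgData C') (P : LaxData S S' → Prop) :=
  { m : LaxData S S' // P m }

instance morCategory {C C' : ℰ} (S : T.AlgData C) (S' : T.AlgData C')
    (P : LaxData S S' → Prop) : Category (Mor S S' P) where
  Hom m m' := { α : m.val.hom ⟶ m'.val.hom // IsTransformation m.val m'.val α }
  id m := ⟨𝟙 m.val.hom, by intro X f; simp⟩
  comp {m m' m''} α β := ⟨α.val ≫ β.val, by
    intro X f
    have hα := α.property X f
    have hβ := β.property X f
    simp only [Bicategory.whiskerLeft_comp, Functor.map_comp, Category.assoc]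
    rw [hβ, ← Category.assoc, hα, Category.assoc]⟩
  id_comp := by intros; apply Subtype.ext; simp
  comp_id := by intros; apply Subtype.ext; simp
  assoc := by intros; apply Subtype.ext; simp

/-- The forgetful functor from a category of morphisms of pseudoalgebras and
transformations to the corresponding hom-category of `ℰ`. -/
@[simps]
def morForget {C C' : ℰ} (S : T.AlgData C) (S' : T.AlgData C') (P : LaxData S S' → Prop) :
    Mor S S' P ⥤ (C ⟶ C') where
  obj m := m.val.hom
  map α := α.val

/-- A pseudoalgebra is lax-idempotent when its unit 2-cells `atil` exhibit the unit of
an adjunction between extension and precomposition with the unit of the pseudomonad. -/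
def IsLaxIdempotent {C : ℰ} (S : T.AlgData C) : Prop :=
  ∀ X : 𝒜, ∃ adj : S.ext X ⊣ precompF C (T.unit X),
    ∀ f : J.obj X ⟶ C, adj.unit.app f = (S.atil f).hom

section Mates

variable {C C' : ℰ} {S : T.AlgData C} {S' : T.AlgData C'} {l : C ⟶ C'} {r : C' ⟶ C}

/-- The 2-cell `f ⇒ rℓf` obtained by whiskering the unit of an adjunction. -/
def nuW (adj : Bicategory.Adjunction l r) {a : ℰ} (f : a ⟶ C) : f ⟶ (f ≫ l) ≫ r :=
  (ρ_ f).inv ≫ f ◁ adj.unit ≫ (α_ f l r).inv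

/-- The 2-cell `ℓrg ⇒ g` obtained by whiskering the counit of an adjunction. -/
def epsW (adj : Bicategory.Adjunction l r) {a : ℰ} (g : a ⟶ C') : (g ≫ r) ≫ l ⟶ g :=
  (α_ g r l).hom ≫ g ◁ adj.counit ≫ (ρ_ g).hom

/-- The colax morphism structure on a left adjoint `ℓ` obtained as the mate of a lax
morphism structure on its right adjoint `r`. -/
def colaxMate (adj : Bicategory.Adjunction l r)
    (rl : ∀ (X : 𝒜) (g : J.obj X ⟶ C'), (S.ext X).obj (g ≫ r) ⟶ (S'.ext X).obj g ≫ r) :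
    ∀ (X : 𝒜) (f : J.obj X ⟶ C), (S.ext X).obj f ≫ l ⟶ (S'.ext X).obj (f ≫ l) :=
  fun X f =>
    (S.ext X).map (nuW adj f) ▷ l ≫ rl X (f ≫ l) ▷ l ≫
      (α_ ((S'.ext X).obj (f ≫ l)) r l).hom ≫ (S'.ext X).obj (f ≫ l) ◁ adj.counit ≫
      (ρ_ ((S'.ext X).obj (f ≫ l))).hom

/-- The lax morphism structure on a right adjoint `r` obtained as the mate of a colax
morphism structure on its left adjoint `ℓ`. -/
def laxMate (adj : Bicategory.Adjunction l r)
    (lc : ∀ (X : 𝒜) (f : J.obj X ⟶ C), (S.ext X).obj f ≫ l ⟶ (S'.ext X).obj (f ≫ l)) :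
    ∀ (X : 𝒜) (g : J.obj X ⟶ C'), (S.ext X).obj (g ≫ r) ⟶ (S'.ext X).obj g ≫ r :=
  fun X g =>
    (ρ_ ((S.ext X).obj (g ≫ r))).inv ≫ (S.ext X).obj (g ≫ r) ◁ adj.unit ≫
      (α_ ((S.ext X).obj (g ≫ r)) l r).inv ≫ lc X (g ≫ r) ▷ r ≫
      (S'.ext X).map (epsW adj g) ▷ r

end Mates

end RelativePseudomonad

end RelPsMnd

namespace RelativePseudomonad

section MateCalculus

variable {𝒜 : Type u₁} [Bicategory.{w₁, v₁} 𝒜] {ℰ : Type u₂} [Bicategory.{w₂, v₂} ℰ]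
  {C C' : ℰ} {l : C ⟶ C'} {r : C' ⟶ C} (adj : Bicategory.Adjunction l r)

theorem nuW_naturality {a : ℰ} {f f' : a ⟶ C} (α : f ⟶ f') :
    α ≫ nuW adj f' = nuW adj f ≫ α ▷ l ▷ r := by
  simp only [nuW, Category.assoc, ← associator_inv_naturality_left,
    rightUnitor_inv_naturality_assoc, whisker_exchange_assoc]

theorem epsW_naturality {a : ℰ} {g g' : a ⟶ C'} (β : g ⟶ g') :
    β ▷ r ▷ l ≫ epsW adj g' = epsW adj g ≫ β := by
  simp only [epsW, Category.assoc, associator_naturality_left_assoc,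
    ← rightUnitor_naturality, whisker_exchange_assoc]

theorem nuW_comp {a b : ℰ} (h : a ⟶ b) (f : b ⟶ C) :
    nuW adj (h ≫ f) ≫ (α_ h f l).hom ▷ r ≫ (α_ h (f ≫ l) r).hom = h ◁ nuW adj f := by
  simp only [nuW]
  bicategory

theorem epsW_comp {a b : ℰ} (h : a ⟶ b) (g : b ⟶ C') :
    epsW adj (h ≫ g) = (α_ h g r).hom ▷ l ≫ (α_ h (g ≫ r) l).hom ≫ h ◁ epsW adj g := by
  simp only [epsW]
  bicategory

theorem nuW_whiskerRight_epsW {a : ℰ} (f : a ⟶ C) :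
    nuW adj f ▷ l ≫ epsW adj (f ≫ l) = 𝟙 (f ≫ l) := by
  have h : nuW adj f ▷ l ≫ epsW adj (f ≫ l) =
      (ρ_ f).inv ▷ l ≫ (α_ _ _ _).hom ≫
        f ◁ leftZigzag adj.unit adj.counit ≫ f ◁ (ρ_ l).hom := by
    simp only [nuW, epsW, leftZigzag]
    bicategory
  rw [h, adj.left_triangle]
  bicategory

theorem nuW_epsW_whiskerRight {a : ℰ} (g : a ⟶ C') :
    nuW adj (g ≫ r) ≫ epsW adj g ▷ r = 𝟙 (g ≫ r) := by
  have h : nuW adj (g ≫ r) ≫ epsW adj g ▷ r =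
      (ρ_ (g ≫ r)).inv ≫ (α_ _ _ _).hom ≫
        g ◁ rightZigzag adj.unit adj.counit ≫ g ◁ (λ_ r).hom := by
    simp only [nuW, epsW, rightZigzag]
    bicategory
  rw [h, adj.right_triangle]
  bicategory

theorem ext_of_nuW {a : ℰ} {p : a ⟶ C} {q : a ⟶ C'} {x y : p ≫ l ⟶ q}
    (h : nuW adj p ≫ x ▷ r = nuW adj p ≫ y ▷ r) : x = y := by
  have key (z : p ≫ l ⟶ q) : z = (nuW adj p ≫ z ▷ r) ▷ l ≫ epsW adj q := by
    rw [comp_whiskerRight, Category.assoc, epsW_naturality, ← Category.assoc,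
      nuW_whiskerRight_epsW, Category.id_comp]
  rw [key x, key y, h]

theorem ext_of_epsW {a : ℰ} {p : a ⟶ C} {q : a ⟶ C'} {x y : p ⟶ q ≫ r}
    (h : x ▷ l ≫ epsW adj q = y ▷ l ≫ epsW adj q) : x = y := by
  have key (z : p ⟶ q ≫ r) : z = nuW adj p ≫ (z ▷ l ≫ epsW adj q) ▷ r := by
    rw [comp_whiskerRight, ← Category.assoc, ← nuW_naturality, Category.assoc,
      nuW_epsW_whiskerRight, Category.comp_id]
  rw [key x, key y, h]

variable {J : Pseudofunctor 𝒜 ℰ} {T : RelativePseudomonad J}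
  {S : T.AlgData C} {S' : T.AlgData C'}
  {rl : ∀ (X : 𝒜) (g : J.obj X ⟶ C'), (S.ext X).obj (g ≫ r) ⟶ (S'.ext X).obj g ≫ r}
  {lc : ∀ (X : 𝒜) (f : J.obj X ⟶ C), (S.ext X).obj f ≫ l ⟶ (S'.ext X).obj (f ≫ l)}

theorem colaxMate_eq (X : 𝒜) (f : J.obj X ⟶ C) :
    colaxMate adj rl X f =
      ((S.ext X).map (nuW adj f) ≫ rl X (f ≫ l)) ▷ l ≫ epsW adj ((S'.ext X).obj (f ≫ l)) := by
  simp [colaxMate, epsW]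

theorem laxMate_eq (X : 𝒜) (g : J.obj X ⟶ C') :
    laxMate adj lc X g =
      nuW adj ((S.ext X).obj (g ≫ r)) ≫ (lc X (g ≫ r) ≫ (S'.ext X).map (epsW adj g)) ▷ r := by
  simp [laxMate, nuW]

theorem nuW_colaxMate (X : 𝒜) (f : J.obj X ⟶ C) :
    nuW adj ((S.ext X).obj f) ≫ colaxMate adj rl X f ▷ r =
      (S.ext X).map (nuW adj f) ≫ rl X (f ≫ l) := by
  rw [colaxMate_eq, comp_whiskerRight, ← Category.assoc, ← nuW_naturality, Category.assoc,
    nuW_epsW_whiskerRight, Category.comp_id]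

theorem laxMate_epsW (X : 𝒜) (g : J.obj X ⟶ C') :
    laxMate adj lc X g ▷ l ≫ epsW adj ((S'.ext X).obj g) =
      lc X (g ≫ r) ≫ (S'.ext X).map (epsW adj g) := by
  rw [laxMate_eq, comp_whiskerRight, Category.assoc, epsW_naturality, ← Category.assoc,
    nuW_whiskerRight_epsW, Category.id_comp]

theorem colaxMate_epsW (hr : (⟨r, rl⟩ : LaxData S' S).IsLaxMorphism)
    (X : 𝒜) (g : J.obj X ⟶ C') :
    colaxMate adj rl X (g ≫ r) ≫ (S'.ext X).map (epsW adj g) =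
      rl X g ▷ l ≫ epsW adj ((S'.ext X).obj g) := by
  have hn : (S.ext X).map (epsW adj g ▷ r) ≫ rl X g =
      rl X ((g ≫ r) ≫ l) ≫ (S'.ext X).map (epsW adj g) ▷ r := hr.natural _
  rw [colaxMate_eq, Category.assoc, ← epsW_naturality, ← comp_whiskerRight_assoc,
    Category.assoc, ← hn, ← Functor.map_comp_assoc, nuW_epsW_whiskerRight]
  simp

theorem nuW_laxMate (hl : (⟨l, lc⟩ : ColaxData S S').IsColaxMorphism)
    (X : 𝒜) (f : J.obj X ⟶ C) :
    (S.ext X).map (nuW adj f) ≫ laxMate adj lc X (f ≫ l) =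
      nuW adj ((S.ext X).obj f) ≫ lc X f ▷ r := by
  have hn : lc X f ≫ (S'.ext X).map (nuW adj f ▷ l) =
      (S.ext X).map (nuW adj f) ▷ l ≫ lc X ((f ≫ l) ≫ r) := hl.natural _
  rw [laxMate_eq, ← Category.assoc, nuW_naturality, Category.assoc, ← comp_whiskerRight,
    ← Category.assoc (_ ▷ l), ← hn, Category.assoc, ← Functor.map_comp, nuW_whiskerRight_epsW]
  simp

/-- A family of 2-cells whose transposes come from a lax structure on the right adjoint is a
colax structure on the left adjoint. -/
theorem isColaxMorphism_of_mate (hS : S.Laws)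
    (hr : (⟨r, rl⟩ : LaxData S' S).IsLaxMorphism)
    (h : ∀ (X : 𝒜) (f : J.obj X ⟶ C), nuW adj ((S.ext X).obj f) ≫ lc X f ▷ r =
      (S.ext X).map (nuW adj f) ≫ rl X (f ≫ l)) :
    (⟨l, lc⟩ : ColaxData S S').IsColaxMorphism where
  natural {X f f'} α := by
    have hn : (S.ext X).map (α ▷ l ▷ r) ≫ rl X (f' ≫ l) =
      rl X (f ≫ l) ≫ (S'.ext X).map (α ▷ l) ▷ r := hr.natural _
    apply ext_of_nuW adj
    dsimp only
    rw [comp_whiskerRight, ← Category.assoc, h, Category.assoc, ← hn, comp_whiskerRight,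
      ← Category.assoc (nuW _ _), ← nuW_naturality, Category.assoc, h,
      ← Functor.map_comp_assoc, ← nuW_naturality, Functor.map_comp_assoc]
  unit {X} f := by
    have hu : (S.atil ((f ≫ l) ≫ r)).hom ≫ T.unit X ◁ rl X (f ≫ l) =
      (S'.atil (f ≫ l)).hom ▷ r ≫ (α_ _ _ _).hom := hr.unit _
    apply ext_of_nuW adj
    dsimp only
    rw [← cancel_mono (α_ _ _ _).hom, Category.assoc, Category.assoc, ← hu,
      ← Category.assoc (nuW _ _) (S.atil _).hom, hS.atil_natural, Category.assoc,
      ← whiskerLeft_comp, ← h, whiskerLeft_comp, ← nuW_comp]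
    simp only [comp_whiskerRight, Category.assoc, whisker_assoc, Iso.inv_hom_id,
      Category.comp_id]
    rw [← Category.assoc (nuW _ _), ← nuW_naturality, Category.assoc]
  assoc {X Y} f g := by
    have ha : (S.ahat f ((g ≫ l) ≫ r)).hom ≫ T.ext.obj f ◁ rl Y (g ≫ l) ≫
          (α_ (T.ext.obj f) ((S'.ext Y).obj (g ≫ l)) r).inv =
        (S.ext X).map (f ◁ rl Y (g ≫ l)) ≫
          (S.ext X).map (α_ f ((S'.ext Y).obj (g ≫ l)) r).inv ≫
          rl X (f ≫ (S'.ext Y).obj (g ≫ l)) ≫ (S'.ahat f (g ≫ l)).hom ▷ r := hr.assoc f (g ≫ l)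
    have hn {p p' : J.obj X ⟶ C'} (β : p ⟶ p') : (S.ext X).map (β ▷ r) ≫ rl X p' =
      rl X p ≫ (S'.ext X).map β ▷ r := hr.natural β
    have hA : (S.ext X).map (f ◁ (S.ext Y).map (nuW adj g)) ≫ (S.ahat f ((g ≫ l) ≫ r)).hom =
        (S.ahat f g).hom ≫ T.ext.obj f ◁ (S.ext Y).map (nuW adj g) := by
      simpa using hS.ahat_natural (𝟙 f) (nuW adj g)
    have hf : nuW adj (f ≫ (S.ext Y).obj g) ≫ ((α_ _ _ _).hom ≫ f ◁ lc Y g) ▷ r =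
        f ◁ (S.ext Y).map (nuW adj g) ≫ f ◁ rl Y (g ≫ l) ≫ (α_ _ _ _).inv := by
      rw [← whiskerLeft_comp_assoc, ← h, whiskerLeft_comp, ← nuW_comp]
      simp
    apply ext_of_nuW adj
    dsimp only
    trans (S.ahat f g).hom ≫ T.ext.obj f ◁ (nuW adj ((S.ext Y).obj g) ≫ lc Y g ▷ r) ≫
      (α_ _ _ _).inv
    · rw [whiskerLeft_comp, ← nuW_comp, comp_whiskerRight, ← Category.assoc (nuW _ _),
        ← nuW_naturality]
      simp
    · rw [h, whiskerLeft_comp, Category.assoc, ← reassoc_of% hA, ha, ← Functor.map_comp_assoc,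
        ← Functor.map_comp_assoc, Category.assoc, ← hf, Functor.map_comp_assoc,
        reassoc_of% hn, ← Functor.map_comp_assoc, comp_whiskerRight (lc _ _),
        ← Category.assoc (nuW _ _), h, Category.assoc, comp_whiskerRight]

/-- A family of 2-cells whose transposes come from a colax structure on the left adjoint is a
lax structure on the right adjoint. -/
theorem isLaxMorphism_of_mate (hS' : S'.Laws)
    (hl : (⟨l, lc⟩ : ColaxData S S').IsColaxMorphism)
    (h : ∀ (X : 𝒜) (g : J.obj X ⟶ C'), rl X g ▷ l ≫ epsW adj ((S'.ext X).obj g) =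
      lc X (g ≫ r) ≫ (S'.ext X).map (epsW adj g)) :
    (⟨r, rl⟩ : LaxData S' S).IsLaxMorphism where
  natural {X g g'} β := by
    have hn : lc X (g ≫ r) ≫ (S'.ext X).map (β ▷ r ▷ l) =
      (S.ext X).map (β ▷ r) ▷ l ≫ lc X (g' ≫ r) := hl.natural _
    apply ext_of_epsW adj
    dsimp only
    rw [comp_whiskerRight, Category.assoc, h, ← reassoc_of% hn, comp_whiskerRight,
      Category.assoc, epsW_naturality, reassoc_of% h, ← Functor.map_comp, ← Functor.map_comp,
      epsW_naturality]
  unit {X} g := by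
    have hu : (S.atil (g ≫ r)).hom ▷ l ≫ (α_ _ _ _).hom ≫ T.unit X ◁ lc X (g ≫ r) =
      (S'.atil ((g ≫ r) ≫ l)).hom := hl.unit _
    dsimp only
    rw [← cancel_mono (α_ _ _ _).inv]
    apply ext_of_epsW adj
    trans (S.atil (g ≫ r)).hom ▷ l ≫ (α_ _ _ _).hom ≫
      T.unit X ◁ (rl X g ▷ l ≫ epsW adj ((S'.ext X).obj g))
    · simp [epsW_comp, ← comp_whiskerRight_assoc]
    · rw [h, whiskerLeft_comp, reassoc_of% hu, ← hS'.atil_natural, ← epsW_naturality]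
      simp
  assoc {X Y} f g := by
    have ha : (S.ahat f (g ≫ r)).hom ▷ l ≫
          (α_ (T.ext.obj f) ((S.ext Y).obj (g ≫ r)) l).hom ≫ T.ext.obj f ◁ lc Y (g ≫ r) =
        lc X (f ≫ (S.ext Y).obj (g ≫ r)) ≫
          (S'.ext X).map (α_ f ((S.ext Y).obj (g ≫ r)) l).hom ≫
          (S'.ext X).map (f ◁ lc Y (g ≫ r)) ≫ (S'.ahat f ((g ≫ r) ≫ l)).hom :=
      hl.assoc f (g ≫ r)
    have hn {p p' : J.obj X ⟶ C} (α : p ⟶ p') : lc X p ≫ (S'.ext X).map (α ▷ l) =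
      (S.ext X).map α ▷ l ≫ lc X p' := hl.natural α
    have hB : (S'.ext X).map (f ◁ (S'.ext Y).map (epsW adj g)) ≫ (S'.ahat f g).hom =
        (S'.ahat f ((g ≫ r) ≫ l)).hom ≫ T.ext.obj f ◁ (S'.ext Y).map (epsW adj g) := by
      simpa using hS'.ahat_natural (𝟙 f) (epsW adj g)
    have hf : (f ◁ rl Y g ≫ (α_ _ _ _).inv) ▷ l ≫ epsW adj (f ≫ (S'.ext Y).obj g) =
        (α_ _ _ _).hom ≫ f ◁ lc Y (g ≫ r) ≫ f ◁ (S'.ext Y).map (epsW adj g) := by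
      rw [← whiskerLeft_comp, ← h, whiskerLeft_comp, epsW_comp]
      simp [← comp_whiskerRight_assoc]
    apply ext_of_epsW adj
    dsimp only
    trans (S.ahat f (g ≫ r)).hom ▷ l ≫ (α_ _ _ _).hom ≫
      T.ext.obj f ◁ (rl Y g ▷ l ≫ epsW adj ((S'.ext Y).obj g))
    · rw [epsW_comp]
      simp [← comp_whiskerRight_assoc]
    · rw [h, whiskerLeft_comp, reassoc_of% ha, ← hB, ← Functor.map_comp_assoc,
        ← Functor.map_comp_assoc, Category.assoc, ← hf, Functor.map_comp_assoc,
        reassoc_of% hn, ← reassoc_of% h, ← epsW_naturality]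
      simp

variable {lc' : ∀ (X : 𝒜) (f : J.obj X ⟶ C), (S'.ext X).obj (f ≫ l) ⟶ (S.ext X).obj f ≫ l}

theorem isLaxMorphism_of_inverse
    (hl : (⟨l, lc⟩ : ColaxData S S').IsColaxMorphism)
    (h₁ : ∀ (X : 𝒜) (f : J.obj X ⟶ C), lc' X f ≫ lc X f = 𝟙 _)
    (h₂ : ∀ (X : 𝒜) (f : J.obj X ⟶ C), lc X f ≫ lc' X f = 𝟙 _) :
    (⟨l, lc'⟩ : LaxData S S').IsLaxMorphism where
  natural {X f f'} α := by
    have hn : lc X f ≫ (S'.ext X).map (α ▷ l) = (S.ext X).map α ▷ l ≫ lc X f' := hl.natural α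
    dsimp only
    rw [← Category.comp_id ((S.ext X).map α ▷ l), ← h₂, ← reassoc_of% hn, reassoc_of% h₁]
  unit {X} f := by
    have hu : (S.atil f).hom ▷ l ≫ (α_ _ _ _).hom ≫ T.unit X ◁ lc X f =
      (S'.atil (f ≫ l)).hom := hl.unit f
    dsimp only
    rw [← hu, Category.assoc, Category.assoc, ← whiskerLeft_comp, h₂, whiskerLeft_id,
      Category.comp_id]
  assoc {X Y} f g := by
    have ha : (S.ahat f g).hom ▷ l ≫ (α_ (T.ext.obj f) ((S.ext Y).obj g) l).hom ≫
          T.ext.obj f ◁ lc Y g =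
        lc X (f ≫ (S.ext Y).obj g) ≫ (S'.ext X).map (α_ f ((S.ext Y).obj g) l).hom ≫
          (S'.ext X).map (f ◁ lc Y g) ≫ (S'.ahat f (g ≫ l)).hom := hl.assoc f g
    dsimp only
    have ha' : (S.ahat f g).hom ▷ l =
        lc X (f ≫ (S.ext Y).obj g) ≫ (S'.ext X).map (α_ f ((S.ext Y).obj g) l).hom ≫
          (S'.ext X).map (f ◁ lc Y g) ≫ (S'.ahat f (g ≫ l)).hom ≫
          T.ext.obj f ◁ lc' Y g ≫ (α_ _ _ _).inv := by
      rw [← reassoc_of% ha, ← whiskerLeft_comp_assoc, h₂]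
      simp
    rw [ha', reassoc_of% h₁, ← Functor.map_comp_assoc _ (α_ _ _ _).inv, Iso.inv_hom_id,
      CategoryTheory.Functor.map_id, Category.id_comp, ← Functor.map_comp_assoc,
      ← whiskerLeft_comp, h₁]
    simp

theorem isColaxMorphism_of_inverse
    (hl : (⟨l, lc'⟩ : LaxData S S').IsLaxMorphism)
    (h₁ : ∀ (X : 𝒜) (f : J.obj X ⟶ C), lc' X f ≫ lc X f = 𝟙 _)
    (h₂ : ∀ (X : 𝒜) (f : J.obj X ⟶ C), lc X f ≫ lc' X f = 𝟙 _) :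
    (⟨l, lc⟩ : ColaxData S S').IsColaxMorphism where
  natural {X f f'} α := by
    have hn : (S'.ext X).map (α ▷ l) ≫ lc' X f' = lc' X f ≫ (S.ext X).map α ▷ l := hl.natural α
    dsimp only
    rw [← Category.comp_id ((S'.ext X).map (α ▷ l)), ← h₁, reassoc_of% hn, reassoc_of% h₂]
  unit {X} f := by
    have hu : (S'.atil (f ≫ l)).hom ≫ T.unit X ◁ lc' X f =
      (S.atil f).hom ▷ l ≫ (α_ _ _ _).hom := hl.unit f
    dsimp only
    rw [← reassoc_of% hu, ← whiskerLeft_comp, h₁, whiskerLeft_id, Category.comp_id]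
  assoc {X Y} f g := by
    have ha : (S'.ahat f (g ≫ l)).hom ≫ T.ext.obj f ◁ lc' Y g ≫
          (α_ (T.ext.obj f) ((S.ext Y).obj g) l).inv =
        (S'.ext X).map (f ◁ lc' Y g) ≫ (S'.ext X).map (α_ f ((S.ext Y).obj g) l).inv ≫
          lc' X (f ≫ (S.ext Y).obj g) ≫ (S.ahat f g).hom ▷ l := hl.assoc f g
    dsimp only
    have ha' : (S'.ahat f (g ≫ l)).hom =
        (S'.ext X).map (f ◁ lc' Y g) ≫ (S'.ext X).map (α_ f ((S.ext Y).obj g) l).inv ≫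
          lc' X (f ≫ (S.ext Y).obj g) ≫ (S.ahat f g).hom ▷ l ≫ (α_ _ _ _).hom ≫
          T.ext.obj f ◁ lc Y g := by
      rw [← reassoc_of% ha, Iso.inv_hom_id_assoc, ← whiskerLeft_comp, h₁]
      simp
    rw [ha', ← Functor.map_comp_assoc _ (f ◁ lc Y g), ← whiskerLeft_comp, h₂, whiskerLeft_id,
      CategoryTheory.Functor.map_id, Category.id_comp, ← Functor.map_comp_assoc, Iso.hom_inv_id,
      CategoryTheory.Functor.map_id, Category.id_comp, reassoc_of% h₂]

variable {rc : ∀ (X : 𝒜) (g : J.obj X ⟶ C'), (S'.ext X).obj g ≫ r ⟶ (S.ext X).obj (g ≫ r)}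

theorem isTransformation_unit_iff :
    IsTransformation (idLaxData S)
        (compLaxData (⟨l, lc'⟩ : LaxData S S') (⟨r, rl⟩ : LaxData S' S)) adj.unit ↔
      ∀ (X : 𝒜) (f : J.obj X ⟶ C),
        (S.ext X).map (nuW adj f) ≫ rl X (f ≫ l) ≫ lc' X f ▷ r =
          nuW adj ((S.ext X).obj f) := by
  refine forall₂_congr fun X f => ?_
  simp only [idLaxData, compLaxData, nuW, Functor.map_comp, Category.assoc]
  rw [← cancel_epi ((S.ext X).map (ρ_ f).hom), ← cancel_mono (α_ ((S.ext X).obj f) l r).hom]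
  simp

theorem isTransformation_counit_iff :
    IsTransformation (compLaxData (⟨r, rl⟩ : LaxData S' S) (⟨l, lc'⟩ : LaxData S S'))
        (idLaxData S') adj.counit ↔
      ∀ (X : 𝒜) (g : J.obj X ⟶ C'),
        lc' X (g ≫ r) ≫ rl X g ▷ l ≫ epsW adj ((S'.ext X).obj g) =
          (S'.ext X).map (epsW adj g) := by
  refine forall₂_congr fun X g => ?_
  simp only [idLaxData, compLaxData, epsW, Functor.map_comp, Category.assoc]
  rw [← cancel_epi ((S'.ext X).map (α_ g r l).hom), ← cancel_mono (ρ_ ((S'.ext X).obj g)).hom]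
  simp [eq_comm]

theorem isColaxTransformation_unit_iff :
    IsColaxTransformation (idColaxData S)
        (compColaxData (⟨l, lc⟩ : ColaxData S S') (⟨r, rc⟩ : ColaxData S' S)) adj.unit ↔
      ∀ (X : 𝒜) (f : J.obj X ⟶ C),
        nuW adj ((S.ext X).obj f) ≫ lc X f ▷ r ≫ rc X (f ≫ l) =
          (S.ext X).map (nuW adj f) := by
  refine forall₂_congr fun X f => ?_
  simp only [idColaxData, compColaxData, nuW, Functor.map_comp, Category.assoc]
  rw [← cancel_epi (ρ_ ((S.ext X).obj f)).inv, ← cancel_mono ((S.ext X).map (α_ f l r).inv)]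
  simp

theorem isColaxTransformation_counit_iff :
    IsColaxTransformation
        (compColaxData (⟨r, rc⟩ : ColaxData S' S) (⟨l, lc⟩ : ColaxData S S'))
        (idColaxData S') adj.counit ↔
      ∀ (X : 𝒜) (g : J.obj X ⟶ C'),
        rc X g ▷ l ≫ lc X (g ≫ r) ≫ (S'.ext X).map (epsW adj g) =
          epsW adj ((S'.ext X).obj g) := by
  refine forall₂_congr fun X g => ?_
  simp only [idColaxData, compColaxData, epsW, Functor.map_comp, Category.assoc]
  rw [← cancel_epi (α_ ((S'.ext X).obj g) r l).hom, ← cancel_mono ((S'.ext X).map (ρ_ g).hom)]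
  simp [eq_comm]

/-- If the unit and counit lift to transformations of lax morphisms, the lax structure on the
left adjoint is inverse to the mate. -/
theorem comp_colaxMate_eq_id (hl : (⟨l, lc'⟩ : LaxData S S').IsLaxMorphism)
    (hν : ∀ (X : 𝒜) (f : J.obj X ⟶ C),
      (S.ext X).map (nuW adj f) ≫ rl X (f ≫ l) ≫ lc' X f ▷ r = nuW adj ((S.ext X).obj f))
    (hε : ∀ (X : 𝒜) (g : J.obj X ⟶ C'),
      lc' X (g ≫ r) ≫ rl X g ▷ l ≫ epsW adj ((S'.ext X).obj g) = (S'.ext X).map (epsW adj g))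
    (X : 𝒜) (f : J.obj X ⟶ C) :
    lc' X f ≫ colaxMate adj rl X f = 𝟙 _ ∧ colaxMate adj rl X f ≫ lc' X f = 𝟙 _ := by
  have hn : (S'.ext X).map (nuW adj f ▷ l) ≫ lc' X ((f ≫ l) ≫ r) =
    lc' X f ≫ (S.ext X).map (nuW adj f) ▷ l := hl.natural _
  constructor
  · rw [colaxMate_eq, comp_whiskerRight, Category.assoc, ← reassoc_of% hn, hε,
      ← Functor.map_comp, nuW_whiskerRight_epsW, CategoryTheory.Functor.map_id]
  · apply ext_of_nuW adj
    rw [comp_whiskerRight, ← Category.assoc, nuW_colaxMate, Category.assoc, hν]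
    simp

/-- If the unit and counit lift to transformations of colax morphisms, the colax structure on
the right adjoint is inverse to the mate. -/
theorem comp_laxMate_eq_id (hr : (⟨r, rc⟩ : ColaxData S' S).IsColaxMorphism)
    (hν : ∀ (X : 𝒜) (f : J.obj X ⟶ C),
      nuW adj ((S.ext X).obj f) ≫ lc X f ▷ r ≫ rc X (f ≫ l) = (S.ext X).map (nuW adj f))
    (hε : ∀ (X : 𝒜) (g : J.obj X ⟶ C'),
      rc X g ▷ l ≫ lc X (g ≫ r) ≫ (S'.ext X).map (epsW adj g) = epsW adj ((S'.ext X).obj g))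
    (X : 𝒜) (g : J.obj X ⟶ C') :
    rc X g ≫ laxMate adj lc X g = 𝟙 _ ∧ laxMate adj lc X g ≫ rc X g = 𝟙 _ := by
  have hn : rc X ((g ≫ r) ≫ l) ≫ (S.ext X).map (epsW adj g ▷ r) =
    (S'.ext X).map (epsW adj g) ▷ r ≫ rc X g := hr.natural _
  constructor
  · apply ext_of_epsW adj
    rw [comp_whiskerRight, Category.assoc, laxMate_epsW, hε]
    simp
  · rw [laxMate_eq, comp_whiskerRight, Category.assoc, Category.assoc, ← hn, reassoc_of% hν,
      ← Functor.map_comp, nuW_epsW_whiskerRight, CategoryTheory.Functor.map_id]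

end MateCalculus

end RelativePseudomonad

open RelativePseudomonad in
/-- Let `(ν, ε) : ℓ ⊣ r` be an adjunction in `ℰ` between the carriers of
two `T`-pseudoalgebras.  (i) Given a lax morphism structure on `r`, the adjunction lifts
along the forgetful pseudofunctor to an adjunction in `PsAlg_l(T)` (i.e. `ℓ` admits a lax
morphism structure making `ν` and `ε` transformations) if and only if the colax mate of
the given lax structure is invertible, in which case the lifted lax structure on `ℓ` is
inverse to the mate.  (ii) Dually, given a colax morphism structure on `ℓ`, the adjunction
lifts to `PsAlg_c(T)` iff the lax mate is invertible, the lifted colax structure on `r`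
being inverse to the mate. -/
theorem adjunction_lifts_iff_mate_invertible
    {𝒜 : Type u₁} [Bicategory.{w₁, v₁} 𝒜] {ℰ : Type u₂} [Bicategory.{w₂, v₂} ℰ]
    {J : Pseudofunctor 𝒜 ℰ} (T : RelativePseudomonad J)
    {CA CB : ℰ} (SA : T.AlgData CA) (SB : T.AlgData CB)
    (hA : SA.Laws) (hB : SB.Laws)
    (ℓ : CA ⟶ CB) (r : CB ⟶ CA) (adj : Bicategory.Adjunction ℓ r) :
    (∀ rl : ∀ (X : 𝒜) (g : J.obj X ⟶ CB),
        (SA.ext X).obj (g ≫ r) ⟶ (SB.ext X).obj g ≫ r,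
      (⟨r, rl⟩ : LaxData SB SA).IsLaxMorphism →
        (((∃ ll : ∀ (X : 𝒜) (f : J.obj X ⟶ CA),
              (SB.ext X).obj (f ≫ ℓ) ⟶ (SA.ext X).obj f ≫ ℓ,
            (⟨ℓ, ll⟩ : LaxData SA SB).IsLaxMorphism ∧
            IsTransformation (idLaxData SA)
              (compLaxData (⟨ℓ, ll⟩ : LaxData SA SB) (⟨r, rl⟩ : LaxData SB SA)) adj.unit ∧
            IsTransformation
              (compLaxData (⟨r, rl⟩ : LaxData SB SA) (⟨ℓ, ll⟩ : LaxData SA SB))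
              (idLaxData SB) adj.counit) ↔
          (∀ (X : 𝒜) (f : J.obj X ⟶ CA), IsIso (colaxMate adj rl X f))) ∧
        (∀ ll : ∀ (X : 𝒜) (f : J.obj X ⟶ CA),
            (SB.ext X).obj (f ≫ ℓ) ⟶ (SA.ext X).obj f ≫ ℓ,
          (⟨ℓ, ll⟩ : LaxData SA SB).IsLaxMorphism →
          IsTransformation (idLaxData SA)
            (compLaxData (⟨ℓ, ll⟩ : LaxData SA SB) (⟨r, rl⟩ : LaxData SB SA)) adj.unit →
          IsTransformation
            (compLaxData (⟨r, rl⟩ : LaxData SB SA) (⟨ℓ, ll⟩ : LaxData SA SB))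
            (idLaxData SB) adj.counit →
          ∀ (X : 𝒜) (f : J.obj X ⟶ CA),
            ll X f ≫ colaxMate adj rl X f = 𝟙 _ ∧
            colaxMate adj rl X f ≫ ll X f = 𝟙 _))) ∧
    (∀ lc : ∀ (X : 𝒜) (f : J.obj X ⟶ CA),
        (SA.ext X).obj f ≫ ℓ ⟶ (SB.ext X).obj (f ≫ ℓ),
      (⟨ℓ, lc⟩ : ColaxData SA SB).IsColaxMorphism →
        (((∃ rc : ∀ (X : 𝒜) (g : J.obj X ⟶ CB),
              (SB.ext X).obj g ≫ r ⟶ (SA.ext X).obj (g ≫ r),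
            (⟨r, rc⟩ : ColaxData SB SA).IsColaxMorphism ∧
            IsColaxTransformation (idColaxData SA)
              (compColaxData (⟨ℓ, lc⟩ : ColaxData SA SB) (⟨r, rc⟩ : ColaxData SB SA))
              adj.unit ∧
            IsColaxTransformation
              (compColaxData (⟨r, rc⟩ : ColaxData SB SA) (⟨ℓ, lc⟩ : ColaxData SA SB))
              (idColaxData SB) adj.counit) ↔
          (∀ (X : 𝒜) (g : J.obj X ⟶ CB), IsIso (laxMate adj lc X g))) ∧
        (∀ rc : ∀ (X : 𝒜) (g : J.obj X ⟶ CB),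
            (SB.ext X).obj g ≫ r ⟶ (SA.ext X).obj (g ≫ r),
          (⟨r, rc⟩ : ColaxData SB SA).IsColaxMorphism →
          IsColaxTransformation (idColaxData SA)
            (compColaxData (⟨ℓ, lc⟩ : ColaxData SA SB) (⟨r, rc⟩ : ColaxData SB SA))
            adj.unit →
          IsColaxTransformation
            (compColaxData (⟨r, rc⟩ : ColaxData SB SA) (⟨ℓ, lc⟩ : ColaxData SA SB))
            (idColaxData SB) adj.counit →
          ∀ (X : 𝒜) (g : J.obj X ⟶ CB),
            rc X g ≫ laxMate adj lc X g = 𝟙 _ ∧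
            laxMate adj lc X g ≫ rc X g = 𝟙 _))) := by
  refine ⟨fun rl hr => ⟨⟨?_, fun h => ?_⟩, fun ll hl hν hε => ?_⟩,
    fun lc hl => ⟨⟨?_, fun h => ?_⟩, fun rc hr hν hε => ?_⟩⟩
  · rintro ⟨ll, hl, hν, hε⟩ X f
    have h := comp_colaxMate_eq_id adj hl ((isTransformation_unit_iff adj).1 hν)
      ((isTransformation_counit_iff adj).1 hε) X f
    exact ⟨ll X f, h.2, h.1⟩
  · refine ⟨fun X f => inv (colaxMate adj rl X f), ?_, ?_, ?_⟩
    · exact isLaxMorphism_of_inverse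
        (isColaxMorphism_of_mate adj hA hr (nuW_colaxMate adj)) (by simp) (by simp)
    · rw [isTransformation_unit_iff]
      intro X f
      rw [← Category.assoc, ← nuW_colaxMate, Category.assoc, ← comp_whiskerRight]
      simp
    · rw [isTransformation_counit_iff]
      intro X g
      rw [← colaxMate_epsW adj hr, IsIso.inv_hom_id_assoc]
  · exact comp_colaxMate_eq_id adj hl ((isTransformation_unit_iff adj).1 hν)
      ((isTransformation_counit_iff adj).1 hε)
  · rintro ⟨rc, hr, hν, hε⟩ X g
    have h := comp_laxMate_eq_id adj hr ((isColaxTransformation_unit_iff adj).1 hν)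
      ((isColaxTransformation_counit_iff adj).1 hε) X g
    exact ⟨rc X g, h.2, h.1⟩
  · refine ⟨fun X g => inv (laxMate adj lc X g), ?_, ?_, ?_⟩
    · exact isColaxMorphism_of_inverse
        (isLaxMorphism_of_mate adj hB hl (laxMate_epsW adj)) (by simp) (by simp)
    · rw [isColaxTransformation_unit_iff]
      intro X f
      rw [← Category.assoc, ← nuW_laxMate adj hl, Category.assoc, IsIso.hom_inv_id,
        Category.comp_id]
    · rw [isColaxTransformation_counit_iff]
      intro X g
      rw [← laxMate_epsW, ← comp_whiskerRight_assoc]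
      simp
  · exact comp_laxMate_eq_id adj hr ((isColaxTransformation_unit_iff adj).1 hν)
      ((isColaxTransformation_counit_iff adj).1 hε)
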